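/- Let D be a strongly connected digraph different from the directed cycle of length 3. Then smc_v(L(D)) = smc(D), where L(D) is the line digraph of D. -/

import Mathlib

namespace SVMC

variable {V : Type*}

/-- `IsWalk A u v l` : `u :: l` is a directed walk from `u` to `v` in the digraph
with arc relation `A`; its length (number of arcs) is `l.length`. -/
def IsWalk (A : V → V → Prop) (u v : V) (l : List V) : Prop :=
  List.Chain A u l ∧ (u :: l).getLast (List.cons_ne_nil u l) = v

/-- A directed path: a walk with no repeated vertices. -/
def IsPath (A : V → V → Prop) (u v : V) (l : List V) : Prop :=
  IsWalk A u v l ∧ (u :: l).Nodup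

def Reachable (A : V → V → Prop) (u v : V) : Prop := ∃ l, IsWalk A u v l

/-- A digraph is strong if every vertex is reachable from every other vertex. -/
def Strong (A : V → V → Prop) : Prop := ∀ u v : V, Reachable A u v

/-- Directed distance: the minimum length of a directed walk from `u` to `v`. -/
noncomputable def dist (A : V → V → Prop) (u v : V) : ℕ :=
  sInf {n | ∃ l, IsWalk A u v l ∧ l.length = n}

/-- Diameter: maximum directed distance over ordered pairs of vertices. -/
noncomputable def diam (A : V → V → Prop) : ℕ :=
  sSup {d | ∃ u v : V, dist A u v = d}

/-- The internal vertices of the walk `u :: l` (ending at the last entry of `l`)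
are `l.dropLast`.  `MonoInternal Γ l` says they all receive one color. -/
def MonoInternal (Γ : V → ℕ) (l : List V) : Prop :=
  ∃ c, ∀ x ∈ l.dropLast, Γ x = c

/-- A strong vertex-monochromatic connection coloring. -/
def IsSVMC (A : V → V → Prop) (Γ : V → ℕ) : Prop :=
  ∀ u v : V, ∃ l, IsPath A u v l ∧ MonoInternal Γ l

/-- The number of colors used by a vertex coloring. -/
noncomputable def colorCount (Γ : V → ℕ) : ℕ := (Set.range Γ).ncard

/-- The strong vertex-monochromatic connection number. -/
noncomputable def smcv (A : V → V → Prop) : ℕ :=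
  sSup {k | ∃ Γ : V → ℕ, IsSVMC A Γ ∧ colorCount Γ = k}

def TotalAbsorbing (A : V → V → Prop) (S : Set V) : Prop := ∀ v : V, ∃ w ∈ S, A v w

def TotalDominating (A : V → V → Prop) (S : Set V) : Prop := ∀ v : V, ∃ w ∈ S, A w v

def Absorbing (A : V → V → Prop) (S : Set V) : Prop := ∀ v ∉ S, ∃ w ∈ S, A v w

def Dominating (A : V → V → Prop) (S : Set V) : Prop := ∀ v ∉ S, ∃ w ∈ S, A w v

/-- A walk all of whose vertices lie in `S`. -/
def IsWalkIn (A : V → V → Prop) (S : Set V) (u v : V) (l : List V) : Prop :=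
  IsWalk A u v l ∧ ∀ x ∈ u :: l, x ∈ S

/-- The subdigraph induced by `S` is strongly connected. -/
def StrongOn (A : V → V → Prop) (S : Set V) : Prop :=
  ∀ u ∈ S, ∀ v ∈ S, ∃ l, IsWalkIn A S u v l

/-- `Ω_v(D)`: minimum order of a strong, absorbing and dominating subdigraph. -/
noncomputable def Omegav (A : V → V → Prop) : ℕ :=
  sInf {k | ∃ S : Set V, S.Nonempty ∧ StrongOn A S ∧ Absorbing A S ∧
    Dominating A S ∧ S.ncard = k}

/-- A directed cycle through `u` with vertex list `u :: l` (length `l.length`). -/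
def IsCycle (A : V → V → Prop) (u : V) (l : List V) : Prop :=
  l ≠ [] ∧ IsWalk A u u l ∧ (u :: l.dropLast).Nodup

/-- The girth: minimum length of a directed cycle. -/
noncomputable def girth (A : V → V → Prop) : ℕ :=
  sInf {n | ∃ u l, IsCycle A u l ∧ l.length = n}

/-- The arcs of the walk `u :: l` are the consecutive pairs, i.e. `(u :: l).zip l`.
`MonoArcs` says they all get one color under the arc coloring `ΓA`. -/
def MonoArcs (ΓA : V → V → ℕ) (u : V) (l : List V) : Prop :=
  ∃ c, ∀ p ∈ (u :: l).zip l, ΓA p.1 p.2 = c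

/-- A strong monochromatic connection (arc) coloring. -/
def IsSMC (A : V → V → Prop) (ΓA : V → V → ℕ) : Prop :=
  ∀ u v : V, ∃ l, IsPath A u v l ∧ MonoArcs ΓA u l

/-- The number of colors used on the arcs. -/
noncomputable def arcColorCount (A : V → V → Prop) (ΓA : V → V → ℕ) : ℕ :=
  ((fun p : V × V => ΓA p.1 p.2) '' {p : V × V | A p.1 p.2}).ncard

/-- The strong monochromatic connection number (arc version). -/
noncomputable def smc (A : V → V → Prop) : ℕ :=
  sSup {k | ∃ ΓA : V → V → ℕ, IsSMC A ΓA ∧ arcColorCount A ΓA = k}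

/-- The number of arcs of a digraph. -/
noncomputable def arcCount (A : V → V → Prop) : ℕ := {p : V × V | A p.1 p.2}.ncard

/-- `Ω(D)`: minimum number of arcs of a strong spanning subdigraph. -/
noncomputable def Omega (A : V → V → Prop) : ℕ :=
  sInf {k | ∃ B : V → V → Prop, (∀ u v, B u v → A u v) ∧ Strong B ∧ arcCount B = k}

/-- The arcs of `A`, as the vertex type of the line digraph. -/
def Arc (A : V → V → Prop) : Type _ := {p : V × V // A p.1 p.2}

/-- Adjacency in the line digraph: head of `e` equals tail of `f`. -/
def lineAdj (A : V → V → Prop) : Arc A → Arc A → Prop :=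
  fun e f => e.1.2 = f.1.1

/-- `(u,v)` is a bad pair: `N⁺(u) = {v}` and `N⁻(v) = {u}`. -/
def BadPair (A : V → V → Prop) (u v : V) : Prop :=
  {w | A u w} = {v} ∧ {w | A w v} = {u}

/-- A tournament: an orientation of a complete graph. -/
def IsTournament (A : V → V → Prop) : Prop :=
  (∀ v, ¬ A v v) ∧ ∀ u v : V, u ≠ v → (A u v ↔ ¬ A v u)

/-- The directed 3-cycle on `Fin 3`. -/
def C3Adj : Fin 3 → Fin 3 → Prop := fun i j => j = i + 1

/-- `A` is isomorphic to the directed 3-cycle. -/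
def IsoC3 (A : V → V → Prop) : Prop :=
  ∃ e : V ≃ Fin 3, ∀ u v : V, A u v ↔ C3Adj (e u) (e v)

end SVMC

namespace SVMC

variable {V : Type*}

/-- Existence of a nodup chain from a reflexive transitive closure. -/
lemma exists_path_of_rtg {R : V → V → Prop} {u v : V} (h : Relation.ReflTransGen R u v) :
    ∃ l, IsPath R u v l := by
  classical
  induction h using Relation.ReflTransGen.head_induction_on with
  | refl => exact ⟨[], ⟨List.IsChain.singleton _, rfl⟩, by simp⟩
  | @head a b hab hbc ih =>
    obtain ⟨l, ⟨hc, hl⟩, hn⟩ := ih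
    by_cases ha : a ∈ b :: l
    · obtain ⟨s, t, hst⟩ := List.append_of_mem ha
      have hc' : List.IsChain R (b :: l) := hc
      rw [hst] at hc' hn
      have hl' : (s ++ a :: t).getLast (by simp) = v := by
        rw [← hl]; congr 1; exact hst.symm
      refine ⟨t, ⟨?_, ?_⟩, ?_⟩
      · exact (List.isChain_append.1 hc').2.1
      · rw [← hl']; simp
      · exact (List.nodup_append.1 hn).2.1
    · refine ⟨b :: l, ⟨?_, ?_⟩, ?_⟩
      · exact List.IsChain.cons_cons hab hc
      · rw [← hl]; simp
      · exact List.nodup_cons.2 ⟨ha, hn⟩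

lemma rtg_of_walk {R : V → V → Prop} {u v : V} {l : List V} (h : IsWalk R u v l) :
    Relation.ReflTransGen R u v := by
  induction l generalizing u with
  | nil => obtain ⟨_, h2⟩ := h; simp at h2; subst h2; exact .refl
  | cons b l ih =>
    obtain ⟨h1, h2⟩ := h
    have h1' : List.IsChain R (u :: b :: l) := h1
    rw [List.isChain_cons_cons] at h1'
    refine .head h1'.1 (ih ⟨h1'.2, ?_⟩)
    rw [← h2]; simp

/-- Monochromatic arcs of colour `k`. -/
def MA (A : V → V → Prop) (G : V → V → ℕ) (k : ℕ) : V → V → Prop :=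
  fun x y => A x y ∧ G x y = k

lemma chain_MA (A : V → V → Prop) (G : V → V → ℕ) (k : ℕ) (u : V) (l : List V) :
    List.IsChain (MA A G k) (u :: l) ↔
      List.IsChain A (u :: l) ∧ ∀ p ∈ (u :: l).zip l, G p.1 p.2 = k := by
  induction l generalizing u with
  | nil => simp
  | cons b l ih =>
    rw [List.isChain_cons_cons, ih, List.isChain_cons_cons, List.zip_cons_cons]
    simp only [List.forall_mem_cons, MA]
    tauto

lemma isSMC_iff (A : V → V → Prop) (G : V → V → ℕ) :
    IsSMC A G ↔ ∀ u v, ∃ k, Relation.ReflTransGen (MA A G k) u v := by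
  constructor
  · intro h u v
    obtain ⟨l, ⟨⟨hc, hl⟩, hn⟩, k, hk⟩ := h u v
    exact ⟨k, rtg_of_walk ⟨(chain_MA A G k u l).2 ⟨hc, hk⟩, hl⟩⟩
  · intro h u v
    obtain ⟨k, hk⟩ := h u v
    obtain ⟨l, ⟨hc, hl⟩, hn⟩ := exists_path_of_rtg hk
    have := (chain_MA A G k u l).1 hc
    exact ⟨l, ⟨⟨this.1, hl⟩, hn⟩, k, this.2⟩

lemma line_walk_to (A : V → V → Prop) (G : V → V → ℕ) (k : ℕ) (f : Arc A) (l : List (Arc A))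
    (e : Arc A) (hw : IsWalk (lineAdj A) e f l) (hne : l ≠ [])
    (hk : ∀ x ∈ l.dropLast, G x.1.1 x.1.2 = k) :
    Relation.ReflTransGen (MA A G k) e.1.2 f.1.1 := by
  induction l generalizing e with
  | nil => exact absurd rfl hne
  | cons g l ih =>
    obtain ⟨h1, h2⟩ := hw
    have h1' : List.IsChain (lineAdj A) (e :: g :: l) := h1
    rw [List.isChain_cons_cons] at h1'
    have hh : e.1.2 = g.1.1 := h1'.1
    rw [hh]
    rcases l with _ | ⟨g', l⟩
    · simp at h2; subst h2; exact .refl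
    · refine .head ⟨g.2, hk g (by simp)⟩ (ih g ⟨h1'.2, ?_⟩ (by simp) ?_)
      · rw [← h2]; simp
      · intro x hx; exact hk x (by simp [hx])

lemma line_of_rtg (A : V → V → Prop) (G : V → V → ℕ) (k : ℕ) (f : Arc A) (a : V)
    (h : Relation.ReflTransGen (MA A G k) a f.1.1) :
    ∀ e : Arc A, e.1.2 = a →
    Relation.ReflTransGen
      (fun x y : Arc A => lineAdj A x y ∧ (G y.1.1 y.1.2 = k ∨ y = f)) e f := by
  induction h using Relation.ReflTransGen.head_induction_on with
  | refl => intro e he; exact .single ⟨he, .inr rfl⟩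
  | @head a b hab hbc ih =>
    intro e he
    exact .head (b := (⟨(a, b), hab.1⟩ : Arc A)) ⟨he, .inl hab.2⟩ (ih _ rfl)

lemma isSVMC_iff (A : V → V → Prop) (G : V → V → ℕ) :
    IsSVMC (lineAdj A) (fun e => G e.1.1 e.1.2) ↔
      ∀ e f : Arc A, e ≠ f → ∃ k, Relation.ReflTransGen (MA A G k) e.1.2 f.1.1 := by
  constructor
  · intro h e f hef
    obtain ⟨l, ⟨hw, hn⟩, k, hk⟩ := h e f
    refine ⟨k, line_walk_to A G k f l e hw ?_ hk⟩
    rintro rfl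
    exact hef hw.2
  · intro h e f
    by_cases hef : e = f
    · subst hef
      exact ⟨[], ⟨⟨List.IsChain.singleton _, rfl⟩, by simp⟩, 0, by simp⟩
    · obtain ⟨k, hk⟩ := h e f hef
      obtain ⟨l, ⟨hc, hl⟩, hn⟩ := exists_path_of_rtg (line_of_rtg A G k f _ hk e rfl)
      have hc' : List.IsChain (fun x y : Arc A =>
        lineAdj A x y ∧ (G y.1.1 y.1.2 = k ∨ y = f)) (e :: l) := hc
      refine ⟨l, ⟨⟨hc'.imp (fun _ _ h => h.1), hl⟩, hn⟩, k, ?_⟩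
      have hl0 : l ≠ [] := by rintro rfl; exact hef hl
      have hlast : l.getLast hl0 = f := by rw [← hl, List.getLast_cons hl0]
      have hmem : ∀ x ∈ l, G x.1.1 x.1.2 = k ∨ x = f := by
        clear hk hl hlast hl0 hn hef hc
        induction l generalizing e with
        | nil => simp
        | cons g l ih =>
          rw [List.isChain_cons_cons] at hc'
          intro x hx
          rcases List.mem_cons.1 hx with rfl | hx
          · exact hc'.1.2
          · exact ih g hc'.2 x hx
      intro x hx
      rcases hmem x (List.mem_of_mem_dropLast hx) with h | h
      · exact h
      · exfalso
        have hn2 : l.Nodup := (List.nodup_cons.1 hn).2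
        rw [← List.dropLast_append_getLast hl0, hlast, List.nodup_append] at hn2
        exact hn2.2.2 x hx f (by simp) h

lemma isoC3_of (A : V → V → Prop) (u w v : V) (huw : u ≠ w) (huv : u ≠ v) (hwv : w ≠ v)
    (hall : ∀ x, x = u ∨ x = w ∨ x = v)
    (h1 : ∀ y, A u y ↔ y = w) (h2 : ∀ y, A w y ↔ y = v) (h3 : ∀ y, A v y ↔ y = u) :
    IsoC3 A := by
  let f : Fin 3 → V := ![u, w, v]
  have hf : Function.Bijective f := by
    constructor
    · intro i j hij
      fin_cases i <;> fin_cases j <;> simp_all [f]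
    · intro x
      rcases hall x with rfl | rfl | rfl
      · exact ⟨0, rfl⟩
      · exact ⟨1, rfl⟩
      · exact ⟨2, rfl⟩
  have hA : ∀ i j, A (f i) (f j) ↔ C3Adj i j := by
    intro i j
    have : C3Adj i j ↔ f j = f (i + 1) := by
      rw [hf.1.eq_iff]; rfl
    rw [this]
    fin_cases i
    · exact h1 _
    · exact h2 _
    · exact h3 _
  refine ⟨(Equiv.ofBijective f hf).symm, fun x y => ?_⟩
  rw [← hA]
  have : ∀ x, f ((Equiv.ofBijective f hf).symm x) = x :=
    fun x => (Equiv.ofBijective f hf).apply_symm_apply x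
  rw [this, this]

lemma core (A : V → V → Prop) (G : V → V → ℕ) (hs : Strong A) (hC3 : ¬ IsoC3 A)
    (H : ∀ a b c d, A a b → A c d → ¬ (a = c ∧ b = d) →
      ∃ k, Relation.ReflTransGen (MA A G k) b c) (u v : V) :
    ∃ k, Relation.ReflTransGen (MA A G k) u v := by
  have hout : ∀ x y : V, x ≠ y → ∃ z, A x z := by
    intro x y hxy
    obtain ⟨l, hl⟩ := hs x y
    rcases (rtg_of_walk hl).cases_head with h | ⟨z, hz, _⟩
    · exact absurd h hxy
    · exact ⟨z, hz⟩
  have hin : ∀ x y : V, x ≠ y → ∃ z, A z y := by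
    intro x y hxy
    obtain ⟨l, hl⟩ := hs x y
    rcases (rtg_of_walk hl).cases_tail with h | ⟨z, _, hz⟩
    · exact absurd h.symm hxy
    · exact ⟨z, hz⟩
  have dich : ∀ x y : V, x ≠ y → (∃ k, Relation.ReflTransGen (MA A G k) x y) ∨
      (A y x ∧ (∀ p, A p x → p = y) ∧ (∀ q, A y q → q = x)) := by
    intro x y hxy
    by_cases h : ∃ k, Relation.ReflTransGen (MA A G k) x y
    · exact .inl h
    right
    have key : ∀ p q, A p x → A y q → p = y ∧ x = q := by
      intro p q hp hq
      by_contra hne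
      exact h (H p x y q hp hq hne)
    obtain ⟨p, hp⟩ := hin y x hxy.symm
    obtain ⟨q, hq⟩ := hout y x hxy.symm
    refine ⟨?_, fun p hp => (key p q hp hq).1, fun q hq => (key p q hp hq).2.symm⟩
    rw [← (key p q hp hq).1]; exact hp
  by_cases huv : u = v
  · exact ⟨0, huv ▸ .refl⟩
  by_contra hno
  obtain ⟨hvu, hinu, houtv⟩ := (dich u v huv).resolve_left hno
  have huv' : ¬ A u v := fun h => hno ⟨G u v, .single ⟨h, rfl⟩⟩
  -- every other vertex is exceptional
  have hex : ∀ x, x ≠ u → x ≠ v →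
      (A x v ∧ (∀ p, A p v → p = x) ∧ (∀ q, A x q → q = v)) ∨
      (A u x ∧ (∀ p, A p x → p = u) ∧ (∀ q, A u q → q = x)) := by
    intro x hxu hxv
    rcases dich v x (Ne.symm hxv) with ⟨k, hk⟩ | h
    · rcases dich x u hxu with ⟨k', hk'⟩ | h
      · exfalso
        rcases hk.cases_head with h | ⟨z, hz, hzx⟩
        · exact hxv h.symm
        rcases hk'.cases_tail with h | ⟨z', hz'x, hz'⟩
        · exact hxu h.symm
        obtain rfl := houtv z hz.1
        obtain rfl := hinu z' hz'.1
        have : k = k' := hz.2.symm.trans hz'.2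
        subst this
        exact hno ⟨k, hzx.trans hz'x⟩
      · exact .inr h
    · exact .inl h
  obtain ⟨w1, hw1⟩ := hout u v huv
  obtain ⟨w2, hw2⟩ := hin u v huv
  have h1v : w1 ≠ v := by rintro rfl; exact huv' hw1
  have h1u : w1 ≠ u := by rintro rfl; exact huv (hinu _ hw1)
  have h2u : w2 ≠ u := by rintro rfl; exact huv' hw2
  have h2v : w2 ≠ v := by rintro rfl; exact huv (houtv _ hw2).symm
  have hall : ∀ x, x = u ∨ x = v ∨ x = w1 ∨ x = w2 := by
    intro x
    by_cases hxu : x = u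
    · exact .inl hxu
    by_cases hxv : x = v
    · exact .inr (.inl hxv)
    rcases hex x hxu hxv with h | h
    · exact .inr (.inr (.inr (h.2.1 w2 hw2).symm))
    · exact .inr (.inr (.inl (h.2.2 w1 hw1).symm))
  by_cases h12 : w1 = w2
  · subst h12
    have hnu : ∀ y, A y u → y = v := hinu
    apply hC3
    refine isoC3_of A u w1 v h1u.symm huv h1v (fun x => by have := hall x; tauto) ?_ ?_ ?_
    · intro y
      refine ⟨fun hy => ?_, fun hy => hy ▸ hw1⟩
      rcases hall y with rfl | rfl | rfl | rfl
      · exact absurd (hinu _ hy) huv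
      · exact absurd hy huv'
      · rfl
      · rfl
    · intro y
      refine ⟨fun hy => ?_, fun hy => hy ▸ hw2⟩
      rcases hex w1 h1u h1v with h | h
      · exact h.2.2 y hy
      · rcases hall y with rfl | rfl | rfl | rfl
        · exact absurd (hinu _ hy) h1v
        · rfl
        · exact absurd (h.2.1 _ hy) h1u
        · exact absurd (h.2.1 _ hy) h1u
    · intro y
      exact ⟨fun hy => houtv y hy, fun hy => hy ▸ hvu⟩
  · have b1 := (hex w1 h1u h1v).resolve_left (fun h => h12 (h.2.1 w2 hw2).symm)
    have b2 := (hex w2 h2u h2v).resolve_right (fun h => h12 (h.2.2 w1 hw1))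
    have hout1 : ∀ y, A w1 y → y = w2 := by
      intro y hy
      rcases hall y with rfl | rfl | rfl | rfl
      · exact absurd (hinu _ hy) h1v
      · exact absurd (b2.2.1 _ hy) h12
      · exact absurd (b1.2.1 _ hy) h1u
      · rfl
    obtain ⟨k, hk⟩ := H v u w2 v hvu hw2 (fun h => h2v h.1.symm)
    obtain ⟨k', hk'⟩ := H u w1 v u hw1 hvu (fun h => huv h.1)
    rcases hk.cases_head with h | ⟨z, hz, hzw⟩
    · exact h2u h.symm
    obtain rfl := b1.2.2 z hz.1
    rcases hzw.cases_head with h | ⟨y, hy, _⟩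
    · exact h12 h
    obtain rfl := hout1 y hy.1
    rcases hk'.cases_head with h | ⟨y', hy', _⟩
    · exact h1v h
    obtain rfl := hout1 y' hy'.1
    have : k = k' := hy.2.symm.trans hy'.2
    subst this
    exact hno ⟨k, .head hz hk'⟩

lemma isSVMC_iff_isSMC (A : V → V → Prop) (G : V → V → ℕ) (hs : Strong A) (hC3 : ¬ IsoC3 A) :
    IsSVMC (lineAdj A) (fun e => G e.1.1 e.1.2) ↔ IsSMC A G := by
  rw [isSVMC_iff, isSMC_iff]
  constructor
  · intro h
    refine core A G hs hC3 ?_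
    intro a b c d hab hcd hne
    refine h ⟨(a, b), hab⟩ ⟨(c, d), hcd⟩ ?_
    intro he
    have := congrArg Subtype.val he
    simp only [Prod.mk.injEq] at this
    exact hne this
  · intro h e f _
    exact h _ _

lemma colorCount_eq (A : V → V → Prop) (G : V → V → ℕ) :
    colorCount (fun e : Arc A => G e.1.1 e.1.2) = arcColorCount A G := by
  unfold colorCount arcColorCount
  congr 1
  ext n
  constructor
  · rintro ⟨e, rfl⟩; exact ⟨e.1, e.2, rfl⟩
  · rintro ⟨p, hp, rfl⟩; exact ⟨⟨p, hp⟩, rfl⟩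

end SVMC

/-- for a strong digraph `D` different from the directed 3-cycle,
`smc_v(L(D)) = smc(D)`. -/
theorem smcv_lineDigraph_eq_smc {V : Type*} [Fintype V] (A : V → V → Prop)
    (hstrong : SVMC.Strong A) (hC3 : ¬ SVMC.IsoC3 A) :
    SVMC.smcv (SVMC.lineAdj A) = SVMC.smc A := by
  classical
  unfold SVMC.smcv SVMC.smc
  congr 1
  ext k
  constructor
  · rintro ⟨Γ, hΓ, hk⟩
    let G : V → V → ℕ := fun x y => if h : A x y then Γ ⟨(x, y), h⟩ else 0
    have hG : Γ = fun e : SVMC.Arc A => G e.1.1 e.1.2 := by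
      funext e
      have he : A e.1.1 e.1.2 := e.2
      simp only [G, dif_pos he]
      rfl
    rw [hG] at hΓ hk
    exact ⟨G, (SVMC.isSVMC_iff_isSMC A G hstrong hC3).1 hΓ,
      (SVMC.colorCount_eq A G).symm.trans hk⟩
  · rintro ⟨G, hG, hk⟩
    exact ⟨fun e => G e.1.1 e.1.2, (SVMC.isSVMC_iff_isSMC A G hstrong hC3).2 hG,
      (SVMC.colorCount_eq A G).trans hk⟩
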